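/- arXiv:2506.18420 — 5 statements merged into one kernel-verified Lean document; each statement's English description precedes it below -/
import Mathlib

section
/- Let U ⊆ ℝ³ be open, let ρ, θ: U → ℝ and u: U → ℝ³ be differentiable, and define g(x, v) = (ρ(x) + v·u(x) + ((|v|² − 3)/2)θ(x))√(μ(v)). If for every x ∈ U the function v ↦ Σ_{i=1}^{3} v_i ∂_{x_i} g(x, v) is orthogonal in L²(ℝ³, dv) to each of the five functions √μ, v₁√μ, v₂√μ, v₃√μ, and ((|v|² − 3)/2)√μ, then div u = 0 on U and ∇(ρ + θ) = 0 on U (the incompressibility condition and the Boussinesq relation). -/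
open Real MeasureTheory
open scoped RealInnerProductSpace

noncomputable section

/-- The global Maxwellian `μ(v) = (2π)^(−3/2) exp(−|v|²/2)` on `ℝ³`. -/
def gaussMu (v : EuclideanSpace ℝ (Fin 3)) : ℝ :=
  (2 * π) ^ (-(3 : ℝ) / 2) * Real.exp (-‖v‖ ^ 2 / 2)

/-- Kronecker delta. -/
def kron (i j : Fin 3) : ℝ := if i = j then 1 else 0

/-- Burnett function `𝒜_{ij}(v) = (vᵢvⱼ − (δᵢⱼ/3)|v|²)√μ(v)`. -/
def burnettA (i j : Fin 3) (v : EuclideanSpace ℝ (Fin 3)) : ℝ :=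
  (v i * v j - kron i j / 3 * ‖v‖ ^ 2) * Real.sqrt (gaussMu v)

/-- Burnett function `ℬ_i(v) = ((|v|²−5)/2) vᵢ √μ(v)`. -/
def burnettB (i : Fin 3) (v : EuclideanSpace ℝ (Fin 3)) : ℝ :=
  (‖v‖ ^ 2 - 5) / 2 * v i * Real.sqrt (gaussMu v)

/-- The function `𝒞(v) = (|v|⁴/4 − 5|v|²/2 + 15/4)√μ(v)`. -/
def burnettC (v : EuclideanSpace ℝ (Fin 3)) : ℝ :=
  (‖v‖ ^ 4 / 4 - 5 * ‖v‖ ^ 2 / 2 + 15 / 4) * Real.sqrt (gaussMu v)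

/-- Partial derivative `∂_{x_i} f(x)` of a scalar function on `ℝ³`. -/
def pder (f : EuclideanSpace ℝ (Fin 3) → ℝ) (i : Fin 3) (x : EuclideanSpace ℝ (Fin 3)) : ℝ :=
  fderiv ℝ f x (EuclideanSpace.single i 1)

open ProbabilityTheory

theorem gaussMu_eq_prod (v : EuclideanSpace ℝ (Fin 3)) :
    gaussMu v = ∏ i, gaussianPDFReal 0 1 (v i) := by
  have hc : (2 * π) ^ (-(3 : ℝ) / 2) = (√(2 * π))⁻¹ ^ 3 := by
    rw [Real.sqrt_eq_rpow, ← Real.rpow_neg (by positivity), ← Real.rpow_natCast,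
      ← Real.rpow_mul (by positivity)]
    norm_num
  simp only [gaussMu, gaussianPDFReal, Finset.prod_mul_distrib, ← Real.exp_sum]
  simp only [NNReal.coe_one, mul_one, sub_zero, Finset.prod_const, Finset.card_univ,
    Fintype.card_fin, hc, EuclideanSpace.real_norm_sq_eq, Fin.sum_univ_three]
  ring_nf

theorem integrable_pow_mul_gaussianPDFReal (n : ℕ) :
    Integrable fun x : ℝ => x ^ n * gaussianPDFReal 0 1 x := by
  have h := (integrable_rpow_mul_exp_neg_mul_sq (b := 1 / 2) (by norm_num) (s := n)
    (by linarith [n.cast_nonneg (α := ℝ)])).const_mul (√(2 * π))⁻¹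
  refine h.congr (ae_of_all _ fun x => ?_)
  simp only [gaussianPDFReal, Real.rpow_natCast, NNReal.coe_one, mul_one, sub_zero]
  ring_nf

theorem hasDerivAt_gaussianPDFReal (x : ℝ) :
    HasDerivAt (gaussianPDFReal 0 1) (-(x * gaussianPDFReal 0 1 x)) x := by
  have h : HasDerivAt (fun y : ℝ => -(y - 0) ^ 2 / (2 * ((1 : NNReal) : ℝ))) (-x) x := by
    refine HasDerivAt.congr_deriv ((((hasDerivAt_id x).sub_const 0).pow 2).neg.div_const
      (2 * ((1 : NNReal) : ℝ))) ?_
    simp [neg_div]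
  refine HasDerivAt.congr_deriv (h.exp.const_mul (√(2 * π * ((1 : NNReal) : ℝ)))⁻¹) ?_
  simp only [gaussianPDFReal]
  ring

theorem integral_id_mul_gaussianPDFReal : ∫ x : ℝ, x * gaussianPDFReal 0 1 x = 0 := by
  have h := integral_eq_zero_of_hasDerivAt_of_integrable hasDerivAt_gaussianPDFReal
    (by simpa using (integrable_pow_mul_gaussianPDFReal 1).neg) (integrable_gaussianPDFReal 0 1)
  simpa [integral_neg] using h

theorem integral_pow_add_two_mul_gaussianPDFReal (n : ℕ) :
    ∫ x : ℝ, x ^ (n + 2) * gaussianPDFReal 0 1 x =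
      (n + 1) * ∫ x : ℝ, x ^ n * gaussianPDFReal 0 1 x := by
  have hn := (integrable_pow_mul_gaussianPDFReal n).const_mul ((n : ℝ) + 1)
  have hn2 := integrable_pow_mul_gaussianPDFReal (n + 2)
  have h := integral_eq_zero_of_hasDerivAt_of_integrable
    (f := fun x : ℝ => x ^ (n + 1) * gaussianPDFReal 0 1 x)
    (f' := fun x : ℝ => (n + 1) * (x ^ n * gaussianPDFReal 0 1 x) -
      x ^ (n + 2) * gaussianPDFReal 0 1 x)
    (fun x => by
      refine HasDerivAt.congr_deriv
        ((hasDerivAt_pow (n + 1) x).mul (hasDerivAt_gaussianPDFReal x)) ?_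
      push_cast
      ring)
    (hn.sub hn2) (integrable_pow_mul_gaussianPDFReal (n + 1))
  rw [integral_sub hn hn2, integral_const_mul] at h
  linarith

theorem integrable_monomial_mul_gaussMu (n : Fin 3 → ℕ) :
    Integrable fun v : EuclideanSpace ℝ (Fin 3) => (∏ i, v i ^ n i) * gaussMu v := by
  simp only [gaussMu_eq_prod, ← Finset.prod_mul_distrib]
  exact (PiLp.volume_preserving_ofLp (Fin 3)).integrable_comp_of_integrable
    (Integrable.fintype_prod fun i => integrable_pow_mul_gaussianPDFReal (n i))

theorem integral_monomial_mul_gaussMu (n : Fin 3 → ℕ) :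
    ∫ v : EuclideanSpace ℝ (Fin 3), (∏ i, v i ^ n i) * gaussMu v =
      ∏ i, ∫ x : ℝ, x ^ n i * gaussianPDFReal 0 1 x := by
  simp only [gaussMu_eq_prod, ← Finset.prod_mul_distrib]
  rw [← integral_fintype_prod_volume_eq_prod fun i (x : ℝ) => x ^ n i * gaussianPDFReal 0 1 x]
  exact (PiLp.volume_preserving_ofLp (Fin 3)).integral_comp
    (MeasurableEquiv.toLp 2 (Fin 3 → ℝ)).symm.measurableEmbedding
    (fun y : Fin 3 → ℝ => ∏ i, y i ^ n i * gaussianPDFReal 0 1 (y i))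

theorem multiset_prod_eq_monomial (s : Multiset (Fin 3)) (v : EuclideanSpace ℝ (Fin 3)) :
    (s.map fun i => v i).prod = ∏ i, v i ^ s.count i := by
  rw [Finset.prod_multiset_map_count]
  exact Finset.prod_subset (Finset.subset_univ _) fun i _ hi => by
    simp [Multiset.count_eq_zero.mpr (by simpa using hi)]

theorem integrable_multiset_prod_mul_gaussMu (s : Multiset (Fin 3)) :
    Integrable fun v : EuclideanSpace ℝ (Fin 3) => (s.map fun i => v i).prod * gaussMu v := by
  simpa only [multiset_prod_eq_monomial] using integrable_monomial_mul_gaussMu fun i => s.count i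

theorem integral_multiset_prod_mul_gaussMu (s : Multiset (Fin 3)) :
    ∫ v : EuclideanSpace ℝ (Fin 3), (s.map fun i => v i).prod * gaussMu v =
      ∏ i, ∫ x : ℝ, x ^ s.count i * gaussianPDFReal 0 1 x := by
  simpa only [multiset_prod_eq_monomial] using integral_monomial_mul_gaussMu fun i => s.count i

/-- The integral of an odd function vanishes, whether or not the function is integrable. -/
theorem integral_eq_zero_of_odd {f : EuclideanSpace ℝ (Fin 3) → ℝ} (hf : ∀ v, f (-v) = -f v) :
    ∫ v, f v = 0 := by
  have h := integral_neg_eq_self f volume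
  simp only [hf, integral_neg] at h
  linarith

theorem gaussMu_neg (v : EuclideanSpace ℝ (Fin 3)) : gaussMu (-v) = gaussMu v := by
  simp [gaussMu]

theorem integrable_coord_mul_gaussMu (i : Fin 3) :
    Integrable fun v : EuclideanSpace ℝ (Fin 3) => v i * gaussMu v := by
  simpa using integrable_multiset_prod_mul_gaussMu {i}

theorem integrable_coord_mul_coord_mul_gaussMu (i j : Fin 3) :
    Integrable fun v : EuclideanSpace ℝ (Fin 3) => v i * v j * gaussMu v := by
  simpa using integrable_multiset_prod_mul_gaussMu {i, j}

theorem integrable_coord_mul_coord_mul_coord_mul_gaussMu (i j k : Fin 3) :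
    Integrable fun v : EuclideanSpace ℝ (Fin 3) => v i * v j * v k * gaussMu v := by
  simpa [mul_assoc] using integrable_multiset_prod_mul_gaussMu {i, j, k}

theorem integrable_coord_mul_energy_mul_gaussMu (i : Fin 3) :
    Integrable fun v : EuclideanSpace ℝ (Fin 3) => v i * ((‖v‖ ^ 2 - 3) / 2) * gaussMu v := by
  have h := ((integrable_finsetSum Finset.univ fun j _ =>
    integrable_multiset_prod_mul_gaussMu {j, j, i}).sub
      ((integrable_coord_mul_gaussMu i).const_mul 3)).div_const 2
  refine h.congr (ae_of_all _ fun v => ?_)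
  simp [EuclideanSpace.real_norm_sq_eq, Fin.sum_univ_three]
  ring

theorem integrable_coord_mul_energy_mul_coord_mul_gaussMu (i k : Fin 3) :
    Integrable fun v : EuclideanSpace ℝ (Fin 3) =>
      v i * ((‖v‖ ^ 2 - 3) / 2) * v k * gaussMu v := by
  have h := ((integrable_finsetSum Finset.univ fun j _ =>
    integrable_multiset_prod_mul_gaussMu {j, j, i, k}).sub
      ((integrable_coord_mul_coord_mul_gaussMu i k).const_mul 3)).div_const 2
  refine h.congr (ae_of_all _ fun v => ?_)
  simp [EuclideanSpace.real_norm_sq_eq, Fin.sum_univ_three]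
  ring

theorem integral_pow_two_mul_gaussianPDFReal :
    ∫ x : ℝ, x ^ 2 * gaussianPDFReal 0 1 x = 1 := by
  simpa [integral_gaussianPDFReal_eq_one] using integral_pow_add_two_mul_gaussianPDFReal 0

theorem integral_pow_three_mul_gaussianPDFReal :
    ∫ x : ℝ, x ^ 3 * gaussianPDFReal 0 1 x = 0 := by
  simpa [integral_id_mul_gaussianPDFReal] using integral_pow_add_two_mul_gaussianPDFReal 1

theorem integral_pow_four_mul_gaussianPDFReal :
    ∫ x : ℝ, x ^ 4 * gaussianPDFReal 0 1 x = 3 := by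
  have h := integral_pow_add_two_mul_gaussianPDFReal 2
  rw [integral_pow_two_mul_gaussianPDFReal] at h
  norm_num at h
  exact h

theorem integral_coord_mul_coord_mul_gaussMu (i j : Fin 3) :
    ∫ v : EuclideanSpace ℝ (Fin 3), v i * v j * gaussMu v = kron i j := by
  have h := integral_multiset_prod_mul_gaussMu {i, j}
  simp only [Multiset.insert_eq_cons, Multiset.map_cons, Multiset.map_singleton,
    Multiset.prod_cons, Multiset.prod_singleton] at h
  rw [h]
  fin_cases i <;> fin_cases j <;>
    simp [Fin.prod_univ_three, kron, Multiset.count_singleton, Multiset.count_cons,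
      integral_gaussianPDFReal_eq_one,
      integral_id_mul_gaussianPDFReal, integral_pow_two_mul_gaussianPDFReal]

theorem sum_integral_sq_mul_coord_mul_coord_mul_gaussMu (i k : Fin 3) :
    ∑ j, ∫ v : EuclideanSpace ℝ (Fin 3),
      (Multiset.map (fun i => v i) {j, j, i, k}).prod * gaussMu v = 5 * kron i k := by
  simp only [integral_multiset_prod_mul_gaussMu]
  fin_cases i <;> fin_cases k <;>
    simp [Fin.sum_univ_three, Fin.prod_univ_three, kron, Multiset.count_singleton,
      Multiset.count_cons, integral_gaussianPDFReal_eq_one,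
      integral_id_mul_gaussianPDFReal, integral_pow_two_mul_gaussianPDFReal,
      integral_pow_three_mul_gaussianPDFReal, integral_pow_four_mul_gaussianPDFReal] <;> norm_num

theorem integral_coord_mul_energy_mul_coord_mul_gaussMu (i k : Fin 3) :
    ∫ v : EuclideanSpace ℝ (Fin 3), v i * ((‖v‖ ^ 2 - 3) / 2) * v k * gaussMu v = kron i k := by
  have hs := integrable_finsetSum Finset.univ fun j (_ : j ∈ Finset.univ) =>
    integrable_multiset_prod_mul_gaussMu {j, j, i, k}
  have hd := (integrable_coord_mul_coord_mul_gaussMu i k).const_mul 3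
  calc _ = ∫ v : EuclideanSpace ℝ (Fin 3),
        ((∑ j, (Multiset.map (fun i => v i) {j, j, i, k}).prod * gaussMu v) -
          3 * (v i * v k * gaussMu v)) / 2 := by
        congr 1 with v
        simp [EuclideanSpace.real_norm_sq_eq, Fin.sum_univ_three]
        ring
    _ = kron i k := by
        rw [integral_div, integral_sub hs hd, integral_const_mul,
          integral_finsetSum _ fun j _ => integrable_multiset_prod_mul_gaussMu {j, j, i, k},
          sum_integral_sq_mul_coord_mul_coord_mul_gaussMu, integral_coord_mul_coord_mul_gaussMu]
        ring

theorem pder_infinitesimalMaxwellian {ρ θ : EuclideanSpace ℝ (Fin 3) → ℝ}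
    {u : EuclideanSpace ℝ (Fin 3) → EuclideanSpace ℝ (Fin 3)} {x : EuclideanSpace ℝ (Fin 3)}
    (hρ : DifferentiableAt ℝ ρ x) (hθ : DifferentiableAt ℝ θ x) (hu : DifferentiableAt ℝ u x)
    (w : EuclideanSpace ℝ (Fin 3)) (e s : ℝ) (i : Fin 3) :
    pder (fun y => (ρ y + (∑ k : Fin 3, w k * u y k) + e * θ y) * s) i x =
      (pder ρ i x + (∑ k, w k * pder (fun y => u y k) i x) + e * pder θ i x) * s := by
  have huk : ∀ k, DifferentiableAt ℝ (fun y => u y k) x := differentiableAt_euclidean.mp hu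
  have h := ((hρ.hasFDerivAt.add (HasFDerivAt.fun_sum (u := Finset.univ) fun k _ =>
    (huk k).hasFDerivAt.const_mul (w k))).add (hθ.hasFDerivAt.const_mul e)).mul_const s
  have h' := congrArg (fun L => L (EuclideanSpace.single i 1)) h.fderiv
  refine h'.trans ?_
  simp only [pder, smul_eq_mul, FunLike.coe_smul, FunLike.coe_add, FunLike.coe_sum, Pi.smul_apply,
    Pi.add_apply, Finset.sum_apply]
  ring

/-- Moment form of the pairing of a transport term with a weight `ψ`. -/
theorem integral_transport_mul_gaussMu (a b : Fin 3 → ℝ) (D : Fin 3 → Fin 3 → ℝ)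
    (ψ : EuclideanSpace ℝ (Fin 3) → ℝ)
    (h₁ : ∀ i, Integrable fun v : EuclideanSpace ℝ (Fin 3) => v i * ψ v * gaussMu v)
    (h₂ : ∀ i k, Integrable fun v : EuclideanSpace ℝ (Fin 3) => v i * v k * ψ v * gaussMu v)
    (h₃ : ∀ i, Integrable fun v : EuclideanSpace ℝ (Fin 3) =>
      v i * ((‖v‖ ^ 2 - 3) / 2) * ψ v * gaussMu v) :
    ∫ v : EuclideanSpace ℝ (Fin 3),
      (∑ i, v i * ((a i + (∑ k, v k * D i k) + (‖v‖ ^ 2 - 3) / 2 * b i) * √(gaussMu v))) *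
        (ψ v * √(gaussMu v)) =
      ∑ i, (a i * (∫ v, v i * ψ v * gaussMu v) +
        (∑ k, D i k * ∫ v, v i * v k * ψ v * gaussMu v) +
        b i * ∫ v, v i * ((‖v‖ ^ 2 - 3) / 2) * ψ v * gaussMu v) := by
  have hs (i : Fin 3) : Integrable fun v : EuclideanSpace ℝ (Fin 3) =>
      ∑ k, D i k * (v i * v k * ψ v * gaussMu v) :=
    integrable_finsetSum _ fun k _ => (h₂ i k).const_mul _
  have hs' (i : Fin 3) : Integrable fun v : EuclideanSpace ℝ (Fin 3) =>
      a i * (v i * ψ v * gaussMu v) + ∑ k, D i k * (v i * v k * ψ v * gaussMu v) :=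
    ((h₁ i).const_mul (a i)).add (hs i)
  have hs'' (i : Fin 3) : Integrable fun v : EuclideanSpace ℝ (Fin 3) =>
      a i * (v i * ψ v * gaussMu v) + (∑ k, D i k * (v i * v k * ψ v * gaussMu v)) +
        b i * (v i * ((‖v‖ ^ 2 - 3) / 2) * ψ v * gaussMu v) :=
    (hs' i).add ((h₃ i).const_mul (b i))
  calc _ = ∫ v : EuclideanSpace ℝ (Fin 3), ∑ i, (a i * (v i * ψ v * gaussMu v) +
        (∑ k, D i k * (v i * v k * ψ v * gaussMu v)) +
        b i * (v i * ((‖v‖ ^ 2 - 3) / 2) * ψ v * gaussMu v)) := by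
        congr 1 with v
        have hμ : √(gaussMu v) * √(gaussMu v) = gaussMu v :=
          Real.mul_self_sqrt (by unfold gaussMu; positivity)
        rw [Finset.sum_mul]
        refine Finset.sum_congr rfl fun i _ => ?_
        conv_rhs => rw [← hμ]
        simp only [Fin.sum_univ_three]
        ring
    _ = _ := by
        rw [integral_finsetSum _ fun i _ => hs'' i]
        refine Finset.sum_congr rfl fun i _ => ?_
        rw [integral_add (hs' i) ((h₃ i).const_mul (b i)),
          integral_add ((h₁ i).const_mul (a i)) (hs i),
          integral_finsetSum _ fun k _ => (h₂ i k).const_mul _]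
        simp only [integral_const_mul]

/-- If for every `x ∈ U` the transport term `v ↦ Σᵢ vᵢ ∂_{xᵢ} g(x,v)` of the infinitesimal
Maxwellian `g(x,v) = (ρ(x) + v·u(x) + ((|v|²−3)/2)θ(x))√μ(v)` is orthogonal in `L²(ℝ³, dv)`
to the five collision invariants, then `div u = 0` and `∇(ρ+θ) = 0` on `U`
(incompressibility and the Boussinesq relation). -/
theorem incompressibility_and_Boussinesq_of_solvability
    (U : Set (EuclideanSpace ℝ (Fin 3))) (hU : IsOpen U)
    (ρ θ : EuclideanSpace ℝ (Fin 3) → ℝ)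
    (u : EuclideanSpace ℝ (Fin 3) → EuclideanSpace ℝ (Fin 3))
    (hρ : ∀ x ∈ U, DifferentiableAt ℝ ρ x)
    (hθ : ∀ x ∈ U, DifferentiableAt ℝ θ x)
    (hu : ∀ x ∈ U, DifferentiableAt ℝ u x)
    (horth : ∀ x ∈ U,
      (∫ (v : EuclideanSpace ℝ (Fin 3)),
        (∑ i : Fin 3, v i *
          pder (fun y => (ρ y + (∑ k : Fin 3, v k * u y k) + (‖v‖ ^ 2 - 3) / 2 * θ y) *
            Real.sqrt (gaussMu v)) i x) * Real.sqrt (gaussMu v)) = 0 ∧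
      (∀ k : Fin 3,
        (∫ (v : EuclideanSpace ℝ (Fin 3)),
          (∑ i : Fin 3, v i *
            pder (fun y => (ρ y + (∑ k : Fin 3, v k * u y k) + (‖v‖ ^ 2 - 3) / 2 * θ y) *
              Real.sqrt (gaussMu v)) i x) * (v k * Real.sqrt (gaussMu v))) = 0) ∧
      (∫ (v : EuclideanSpace ℝ (Fin 3)),
        (∑ i : Fin 3, v i *
          pder (fun y => (ρ y + (∑ k : Fin 3, v k * u y k) + (‖v‖ ^ 2 - 3) / 2 * θ y) *
            Real.sqrt (gaussMu v)) i x) * ((‖v‖ ^ 2 - 3) / 2 * Real.sqrt (gaussMu v))) = 0) :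
    ∀ x ∈ U,
      (∑ i : Fin 3, pder (fun y => u y i) i x) = 0 ∧
      (∀ i : Fin 3, pder (fun y => ρ y + θ y) i x = 0) := by
  intro x hx
  obtain ⟨hmass, hmom, -⟩ := horth x hx
  simp only [pder_infinitesimalMaxwellian (hρ x hx) (hθ x hx) (hu x hx)] at hmass hmom
  constructor
  · have h := integral_transport_mul_gaussMu (fun i => pder ρ i x) (fun i => pder θ i x)
      (fun i k => pder (fun y => u y k) i x) (fun _ => 1)
      (by simpa using integrable_coord_mul_gaussMu)
      (by simpa using integrable_coord_mul_coord_mul_gaussMu)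
      (by simpa using integrable_coord_mul_energy_mul_gaussMu)
    have h₁ (i : Fin 3) : ∫ v : EuclideanSpace ℝ (Fin 3), v i * gaussMu v = 0 :=
      integral_eq_zero_of_odd fun v => by simp [gaussMu_neg]
    have h₃ (i : Fin 3) :
        ∫ v : EuclideanSpace ℝ (Fin 3), v i * ((‖v‖ ^ 2 - 3) / 2) * gaussMu v = 0 :=
      integral_eq_zero_of_odd fun v => by simp [gaussMu_neg]
    simp only [one_mul, mul_one, hmass, h₁, h₃, integral_coord_mul_coord_mul_gaussMu] at h
    simpa [kron] using h.symm
  · intro k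
    have h := integral_transport_mul_gaussMu (fun i => pder ρ i x) (fun i => pder θ i x)
      (fun i k => pder (fun y => u y k) i x) (fun v => v k)
      (fun i => integrable_coord_mul_coord_mul_gaussMu i k)
      (fun i j => integrable_coord_mul_coord_mul_coord_mul_gaussMu i j k)
      (fun i => integrable_coord_mul_energy_mul_coord_mul_gaussMu i k)
    have h₂ (i j : Fin 3) : ∫ v : EuclideanSpace ℝ (Fin 3), v i * v j * v k * gaussMu v = 0 :=
      integral_eq_zero_of_odd fun v => by simp [gaussMu_neg]
    simp only [hmom k, h₂, integral_coord_mul_coord_mul_gaussMu,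
      integral_coord_mul_energy_mul_coord_mul_gaussMu] at h
    have hadd : pder (fun y => ρ y + θ y) k x = pder ρ k x + pder θ k x := by
      simp [pder, fderiv_fun_add (hρ x hx) (hθ x hx)]
    rw [hadd]
    simpa [kron, Finset.sum_add_distrib] using h.symm
end
end

section
/- Let −3 < γ ≤ 1. Then there exists a constant C ≥ 1 such that for all v ∈ ℝ³: C^{-1}(1 + |v|²)^{γ/2} ≤ ∫_{ℝ³} |v − w|^{γ} μ(w) dw ≤ C(1 + |v|²)^{γ/2}. -/
open Real MeasureTheory
open scoped RealInnerProductSpace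

noncomputable section

/-- Powers of comparable positive numbers are comparable, uniformly in exponents `|s| ≤ 2`. -/
lemma rpow_le_sq_mul_rpow_of_le_mul {a b k s : ℝ} (ha : 0 < a) (hb : 0 < b) (hk : 1 ≤ k)
    (hab : a ≤ k * b) (hba : b ≤ k * a) (hs₁ : -2 ≤ s) (hs₂ : s ≤ 2) :
    a ^ s ≤ k ^ 2 * b ^ s := by
  have hk0 : 0 < k := by linarith
  rcases le_total 0 s with hs | hs
  · calc a ^ s ≤ (k * b) ^ s := rpow_le_rpow ha.le hab hs
      _ = k ^ s * b ^ s := mul_rpow hk0.le hb.le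
      _ ≤ k ^ (2 : ℝ) * b ^ s := by gcongr
      _ = k ^ 2 * b ^ s := by rw [rpow_two]
  · calc a ^ s = k ^ (-s) * (k * a) ^ s := by
          rw [mul_rpow hk0.le ha.le, ← mul_assoc, ← rpow_add hk0]; simp
      _ ≤ k ^ (-s) * b ^ s := by
          gcongr ?_ * ?_
          exact rpow_le_rpow_of_nonpos hb hba hs
      _ ≤ k ^ (2 : ℝ) * b ^ s := by gcongr; linarith
      _ = k ^ 2 * b ^ s := by rw [rpow_two]

section NormedGroup

variable {E : Type*} [NormedAddCommGroup E]

/-- Peetre's inequality. -/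
lemma one_add_norm_sq_le_mul (v w : E) :
    1 + ‖v‖ ^ 2 ≤ 2 * (1 + ‖w‖ ^ 2) * (1 + ‖v - w‖ ^ 2) := by
  have h : ‖v‖ ≤ ‖w‖ + ‖v - w‖ := by simpa using norm_add_le w (v - w)
  have h2 : ‖v‖ ^ 2 ≤ (‖w‖ + ‖v - w‖) ^ 2 := by gcongr
  nlinarith [sq_nonneg (‖w‖ - ‖v - w‖), sq_nonneg (‖w‖ * ‖v - w‖)]

lemma one_add_norm_sub_sq_le_mul (v w : E) :
    1 + ‖v - w‖ ^ 2 ≤ 2 * (1 + ‖w‖ ^ 2) * (1 + ‖v‖ ^ 2) := by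
  simpa using one_add_norm_sq_le_mul (v - w) (-w)

lemma rpow_bracket_sub_le (v w : E) {s : ℝ} (hs₁ : -2 ≤ s) (hs₂ : s ≤ 2) :
    (1 + ‖v - w‖ ^ 2) ^ s ≤ (2 * (1 + ‖w‖ ^ 2)) ^ 2 * (1 + ‖v‖ ^ 2) ^ s :=
  rpow_le_sq_mul_rpow_of_le_mul (by positivity) (by positivity) (by nlinarith [sq_nonneg ‖w‖])
    (one_add_norm_sub_sq_le_mul v w) (one_add_norm_sq_le_mul v w) hs₁ hs₂

lemma rpow_bracket_le_sub (v w : E) {s : ℝ} (hs₁ : -2 ≤ s) (hs₂ : s ≤ 2) :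
    (1 + ‖v‖ ^ 2) ^ s ≤ (2 * (1 + ‖w‖ ^ 2)) ^ 2 * (1 + ‖v - w‖ ^ 2) ^ s := by
  simpa using rpow_bracket_sub_le (v - w) (-w) hs₁ hs₂

lemma norm_sq_rpow_half (u : E) (γ : ℝ) : (‖u‖ ^ 2) ^ (γ / 2) = ‖u‖ ^ γ := by
  rw [← rpow_natCast_mul (norm_nonneg u)]; congr 1; push_cast; ring

lemma rpow_bracket_le_norm_rpow {γ : ℝ} (hγ₁ : -4 ≤ γ) (hγ₂ : γ ≤ 4) {u : E} (hu : 1 ≤ ‖u‖) :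
    (1 + ‖u‖ ^ 2) ^ (γ / 2) ≤ 4 * ‖u‖ ^ γ := by
  rw [← norm_sq_rpow_half]
  convert rpow_le_sq_mul_rpow_of_le_mul (a := 1 + ‖u‖ ^ 2) (b := ‖u‖ ^ 2) (k := 2) (s := γ / 2)
    (by positivity) (by positivity) (by norm_num) (by nlinarith) (by nlinarith)
    (by linarith) (by linarith) using 2
  norm_num

/-- The power `‖u‖ ^ γ` is bounded by the bracket, up to its local singularity at the origin. -/
lemma norm_rpow_le_rpow_bracket_mul {γ : ℝ} (hγ₁ : -4 ≤ γ) (hγ₂ : γ ≤ 4) (u : E) :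
    ‖u‖ ^ γ ≤ 4 * (1 + ‖u‖ ^ 2) ^ (γ / 2) *
      (1 + (Metric.ball (0 : E) 1).indicator (fun x ↦ ‖x‖ ^ γ) u) := by
  rcases lt_or_ge ‖u‖ 1 with hu | hu
  · have h := rpow_le_sq_mul_rpow_of_le_mul (a := 1) (b := 1 + ‖u‖ ^ 2) (k := 2) (s := γ / 2)
      one_pos (by positivity) (by norm_num) (by nlinarith [sq_nonneg ‖u‖])
      (by nlinarith [norm_nonneg u]) (by linarith) (by linarith)
    rw [one_rpow] at h
    rw [Set.indicator_of_mem (by simpa using hu)]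
    have h0 : 0 ≤ ‖u‖ ^ γ := by positivity
    nlinarith [mul_le_mul_of_nonneg_right h h0]
  · rw [Set.indicator_of_notMem (by simpa using hu), add_zero, mul_one]
    rw [← norm_sq_rpow_half]
    convert rpow_le_sq_mul_rpow_of_le_mul (a := ‖u‖ ^ 2) (b := 1 + ‖u‖ ^ 2) (k := 2) (s := γ / 2)
      (by positivity) (by positivity) (by norm_num) (by nlinarith) (by nlinarith)
      (by linarith) (by linarith) using 2
    norm_num

end NormedGroup

lemma exp_neg_sq_half_mul_le (r : ℝ) :
    (1 + r ^ 2) ^ 4 * exp (-r ^ 2 / 2) ≤ 384 * exp (1 / 2) := by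
  have h := pow_div_factorial_le_exp (x := (1 + r ^ 2) / 2) (by positivity) 4
  have hf : ((Nat.factorial 4 : ℕ) : ℝ) = 24 := by norm_num [Nat.factorial]
  rw [hf] at h
  have h' : (1 + r ^ 2) ^ 4 ≤ 384 * exp ((1 + r ^ 2) / 2) := by
    linear_combination 384 * h
  calc (1 + r ^ 2) ^ 4 * exp (-r ^ 2 / 2)
      ≤ 384 * exp ((1 + r ^ 2) / 2) * exp (-r ^ 2 / 2) := by gcongr
    _ = 384 * exp (1 / 2) := by
      rw [mul_assoc, ← exp_add]; congr 2; ring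

lemma gaussMu_nonneg (w : EuclideanSpace ℝ (Fin 3)) : 0 ≤ gaussMu w := by
  unfold gaussMu; positivity

/-- The Maxwellian absorbs the weight in Peetre's inequality, leaving an integrable decay. -/
lemma exists_sq_bracket_mul_gaussMu_le :
    ∃ K : ℝ, 0 < K ∧ ∀ w, (2 * (1 + ‖w‖ ^ 2)) ^ 2 * gaussMu w ≤
      K * (1 + ‖w‖ ^ 2) ^ (-(4 : ℝ) / 2) := by
  refine ⟨4 * (2 * π) ^ (-(3 : ℝ) / 2) * (384 * exp (1 / 2)), by positivity, fun w ↦ ?_⟩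
  have hJ : 0 < 1 + ‖w‖ ^ 2 := by positivity
  have h2 : (1 + ‖w‖ ^ 2) ^ (-(4 : ℝ) / 2) = ((1 + ‖w‖ ^ 2) ^ 2)⁻¹ := by
    rw [show -(4 : ℝ) / 2 = -((2 : ℕ) : ℝ) by norm_num, rpow_neg hJ.le, rpow_natCast]
  rw [h2, ← div_eq_mul_inv, le_div_iff₀ (by positivity)]
  calc _ = 4 * (2 * π) ^ (-(3 : ℝ) / 2) * ((1 + ‖w‖ ^ 2) ^ 4 * exp (-‖w‖ ^ 2 / 2)) := by
        unfold gaussMu; ring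
    _ ≤ _ := mul_le_mul_of_nonneg_left (exp_neg_sq_half_mul_le _) (by positivity)

lemma integrable_indicator_ball_norm_rpow {γ : ℝ} (hγ : -3 < γ) :
    Integrable ((Metric.ball (0 : EuclideanSpace ℝ (Fin 3)) 1).indicator fun x ↦ ‖x‖ ^ γ) := by
  rw [integrable_indicator_iff measurableSet_ball]
  refine integrableOn_ball_of_norm_le_rpow (C := 1) (α := -γ) (by simp) (by simp; linarith)
    (.of_forall fun x ↦ ?_) (by fun_prop : Measurable _).aestronglyMeasurable
  rw [neg_neg, one_mul, norm_of_nonneg (by positivity)]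

/-- A dominating function for the collision frequency integrand whose integral is
a constant multiple of the bracket. -/
lemma exists_collision_integrand_le {γ : ℝ} (hγ₁ : -3 < γ) (hγ₂ : γ ≤ 1) :
    ∃ K : ℝ, 0 < K ∧ ∀ v w : EuclideanSpace ℝ (Fin 3), ‖v - w‖ ^ γ * gaussMu w ≤
      K * (1 + ‖v‖ ^ 2) ^ (γ / 2) * ((1 + ‖w‖ ^ 2) ^ (-(4 : ℝ) / 2) +
        (Metric.ball (0 : EuclideanSpace ℝ (Fin 3)) 1).indicator (fun x ↦ ‖x‖ ^ γ) (v - w)) := by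
  obtain ⟨K, hK, hKw⟩ := exists_sq_bracket_mul_gaussMu_le
  refine ⟨4 * K, by positivity, fun v w ↦ ?_⟩
  set g := (Metric.ball (0 : EuclideanSpace ℝ (Fin 3)) 1).indicator (fun x ↦ ‖x‖ ^ γ) (v - w)
  have hg0 : 0 ≤ g := Set.indicator_nonneg (fun _ _ ↦ by positivity) _
  have hμ := gaussMu_nonneg w
  have hh : (1 + ‖w‖ ^ 2) ^ (-(4 : ℝ) / 2) ≤ 1 :=
    rpow_le_one_of_one_le_of_nonpos (by nlinarith [sq_nonneg ‖w‖]) (by norm_num)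
  calc ‖v - w‖ ^ γ * gaussMu w
      ≤ 4 * (1 + ‖v - w‖ ^ 2) ^ (γ / 2) * (1 + g) * gaussMu w := by
        gcongr
        exact norm_rpow_le_rpow_bracket_mul (by linarith) (by linarith) _
    _ ≤ 4 * ((2 * (1 + ‖w‖ ^ 2)) ^ 2 * (1 + ‖v‖ ^ 2) ^ (γ / 2)) * (1 + g) * gaussMu w := by
        gcongr
        exact rpow_bracket_sub_le v w (by linarith) (by linarith)
    _ = 4 * (1 + ‖v‖ ^ 2) ^ (γ / 2) * (1 + g) * ((2 * (1 + ‖w‖ ^ 2)) ^ 2 * gaussMu w) := by ring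
    _ ≤ 4 * (1 + ‖v‖ ^ 2) ^ (γ / 2) * (1 + g) * (K * (1 + ‖w‖ ^ 2) ^ (-(4 : ℝ) / 2)) :=
        mul_le_mul_of_nonneg_left (hKw w) (by positivity)
    _ = 4 * K * (1 + ‖v‖ ^ 2) ^ (γ / 2) * ((1 + ‖w‖ ^ 2) ^ (-(4 : ℝ) / 2) +
          g * (1 + ‖w‖ ^ 2) ^ (-(4 : ℝ) / 2)) := by ring
    _ ≤ _ := by
        gcongr
        exact mul_le_of_le_one_right hg0 hh

lemma exists_collisionFrequency_le {γ : ℝ} (hγ₁ : -3 < γ) (hγ₂ : γ ≤ 1) :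
    ∃ A : ℝ, ∀ v : EuclideanSpace ℝ (Fin 3),
      Integrable (fun w : EuclideanSpace ℝ (Fin 3) ↦ ‖v - w‖ ^ γ * gaussMu w) ∧
      ∫ w : EuclideanSpace ℝ (Fin 3), ‖v - w‖ ^ γ * gaussMu w ≤ A * (1 + ‖v‖ ^ 2) ^ (γ / 2) := by
  obtain ⟨K, hK, hle⟩ := exists_collision_integrand_le hγ₁ hγ₂
  have hsing := integrable_indicator_ball_norm_rpow hγ₁
  set g := (Metric.ball (0 : EuclideanSpace ℝ (Fin 3)) 1).indicator (fun x ↦ ‖x‖ ^ γ)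
  have htail : Integrable fun w : EuclideanSpace ℝ (Fin 3) ↦ (1 + ‖w‖ ^ 2) ^ (-(4 : ℝ) / 2) :=
    integrable_rpow_neg_one_add_norm_sq (by simp; norm_num)
  refine ⟨K * ((∫ w : EuclideanSpace ℝ (Fin 3), (1 + ‖w‖ ^ 2) ^ (-(4 : ℝ) / 2)) + ∫ w, g w),
    fun v ↦ ?_⟩
  have hdom := (htail.add (hsing.comp_sub_left v)).const_mul (K * (1 + ‖v‖ ^ 2) ^ (γ / 2))
  have hint : Integrable (fun w : EuclideanSpace ℝ (Fin 3) ↦ ‖v - w‖ ^ γ * gaussMu w) := by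
    refine hdom.mono' ?_ (.of_forall fun w ↦ ?_)
    · unfold gaussMu
      exact (by fun_prop : Measurable _).aestronglyMeasurable
    · rw [norm_of_nonneg (mul_nonneg (by positivity) (gaussMu_nonneg w))]
      exact hle v w
  refine ⟨hint, (integral_mono hint hdom (hle v)).trans_eq ?_⟩
  simp only [Pi.add_apply]
  rw [integral_const_mul, integral_add htail (hsing.comp_sub_left v),
    integral_sub_left_eq_self g volume v]
  ring

lemma volume_real_ball_one_le_sdiff (v : EuclideanSpace ℝ (Fin 3)) :
    volume.real (Metric.ball (0 : EuclideanSpace ℝ (Fin 3)) 1) ≤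
      volume.real (Metric.ball (0 : EuclideanSpace ℝ (Fin 3)) 2 \ Metric.ball v 1) := by
  have h := le_measureReal_sdiff (μ := volume) (s₁ := Metric.ball (0 : EuclideanSpace ℝ (Fin 3)) 2)
    (s₂ := Metric.ball v 1)
  have h2 : volume.real (Metric.ball (0 : EuclideanSpace ℝ (Fin 3)) 2) =
      8 * volume.real (Metric.ball (0 : EuclideanSpace ℝ (Fin 3)) 1) := by
    rw [measureReal_def, Measure.addHaar_ball _ _ (by norm_num), ENNReal.toReal_mul,
      ENNReal.toReal_ofReal (by positivity), measureReal_def]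
    norm_num
  rw [h2, Measure.addHaar_real_ball_center _ v] at h
  linarith [measureReal_nonneg (μ := volume) (s := Metric.ball (0 : EuclideanSpace ℝ (Fin 3)) 1)]

/-- Away from the singularity and on a fixed ball, the integrand dominates the bracket. -/
lemma rpow_bracket_le_collision_integrand {γ : ℝ} (hγ₁ : -3 < γ) (hγ₂ : γ ≤ 1)
    {v w : EuclideanSpace ℝ (Fin 3)} (hw : ‖w‖ ≤ 2) (hvw : 1 ≤ ‖v - w‖) :
    (2 * π) ^ (-(3 : ℝ) / 2) * exp (-2) / 400 * (1 + ‖v‖ ^ 2) ^ (γ / 2) ≤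
      ‖v - w‖ ^ γ * gaussMu w := by
  have hw2 : ‖w‖ ^ 2 ≤ 4 := by nlinarith [norm_nonneg w]
  have hbr : (1 + ‖v‖ ^ 2) ^ (γ / 2) ≤ 400 * ‖v - w‖ ^ γ :=
    calc (1 + ‖v‖ ^ 2) ^ (γ / 2)
        ≤ (2 * (1 + ‖w‖ ^ 2)) ^ 2 * (1 + ‖v - w‖ ^ 2) ^ (γ / 2) :=
          rpow_bracket_le_sub v w (by linarith) (by linarith)
      _ ≤ (2 * (1 + 4)) ^ 2 * (4 * ‖v - w‖ ^ γ) := by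
          gcongr
          exact rpow_bracket_le_norm_rpow (by linarith) (by linarith) hvw
      _ = 400 * ‖v - w‖ ^ γ := by ring
  have hμ : (2 * π) ^ (-(3 : ℝ) / 2) * exp (-2) ≤ gaussMu w := by
    unfold gaussMu
    gcongr
    linarith
  calc _ = (1 + ‖v‖ ^ 2) ^ (γ / 2) / 400 * ((2 * π) ^ (-(3 : ℝ) / 2) * exp (-2)) := by ring
    _ ≤ ‖v - w‖ ^ γ * gaussMu w := by
        gcongr
        linarith

lemma exists_le_collisionFrequency {γ : ℝ} (hγ₁ : -3 < γ) (hγ₂ : γ ≤ 1) :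
    ∃ a : ℝ, 0 < a ∧ ∀ v : EuclideanSpace ℝ (Fin 3),
      a * (1 + ‖v‖ ^ 2) ^ (γ / 2) ≤ ∫ w : EuclideanSpace ℝ (Fin 3), ‖v - w‖ ^ γ * gaussMu w := by
  obtain ⟨A, hA⟩ := exists_collisionFrequency_le hγ₁ hγ₂
  set c : ℝ := (2 * π) ^ (-(3 : ℝ) / 2) * exp (-2) / 400
  have hc0 : 0 < c := by positivity
  have hvol : 0 < volume.real (Metric.ball (0 : EuclideanSpace ℝ (Fin 3)) 1) :=
    ENNReal.toReal_pos (Metric.measure_ball_pos _ _ one_pos).ne' measure_ball_lt_top.ne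
  refine ⟨c * volume.real (Metric.ball (0 : EuclideanSpace ℝ (Fin 3)) 1), by positivity,
    fun v ↦ ?_⟩
  set S := Metric.ball (0 : EuclideanSpace ℝ (Fin 3)) 2 \ Metric.ball v 1
  have hSm : MeasurableSet S := measurableSet_ball.diff measurableSet_ball
  have hSfin : volume S ≠ ⊤ := measure_ne_top_of_subset Set.sdiff_subset measure_ball_lt_top.ne
  have hint := (hA v).1
  calc c * volume.real (Metric.ball (0 : EuclideanSpace ℝ (Fin 3)) 1) * (1 + ‖v‖ ^ 2) ^ (γ / 2)
      ≤ c * volume.real S * (1 + ‖v‖ ^ 2) ^ (γ / 2) := by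
        gcongr ?_ * ?_ * ?_
        exact volume_real_ball_one_le_sdiff v
    _ = ∫ _ in S, c * (1 + ‖v‖ ^ 2) ^ (γ / 2) := by
        rw [setIntegral_const, smul_eq_mul]; ring
    _ ≤ ∫ w in S, ‖v - w‖ ^ γ * gaussMu w := by
        refine setIntegral_mono_on (integrableOn_const hSfin) hint.integrableOn hSm fun w hw ↦ ?_
        refine rpow_bracket_le_collision_integrand hγ₁ hγ₂ ?_ ?_
        · simpa using (Metric.mem_ball.1 hw.1).le
        · simpa [dist_eq_norm_sub'] using hw.2
    _ ≤ ∫ w, ‖v - w‖ ^ γ * gaussMu w :=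
        setIntegral_le_integral hint
          (.of_forall fun w ↦ mul_nonneg (by positivity) (gaussMu_nonneg w))

/-- Two-sided bound for the collision frequency: for `−3 < γ ≤ 1` there is `C ≥ 1` with
`C⁻¹(1+|v|²)^{γ/2} ≤ ∫ |v−w|^γ μ(w) dw ≤ C(1+|v|²)^{γ/2}` for all `v`. -/
theorem collisionFrequency_equiv_bracket (γ : ℝ) (hγ₁ : -3 < γ) (hγ₂ : γ ≤ 1) :
    ∃ C : ℝ, 1 ≤ C ∧ ∀ v : EuclideanSpace ℝ (Fin 3),
      C⁻¹ * (1 + ‖v‖ ^ 2) ^ (γ / 2) ≤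
        (∫ (w : EuclideanSpace ℝ (Fin 3)), ‖v - w‖ ^ γ * gaussMu w) ∧
      (∫ (w : EuclideanSpace ℝ (Fin 3)), ‖v - w‖ ^ γ * gaussMu w) ≤
        C * (1 + ‖v‖ ^ 2) ^ (γ / 2) := by
  obtain ⟨a, ha, hlow⟩ := exists_le_collisionFrequency hγ₁ hγ₂
  obtain ⟨A, hA⟩ := exists_collisionFrequency_le hγ₁ hγ₂
  refine ⟨max 1 (max a⁻¹ A), le_max_left _ _, fun v ↦ ⟨?_, ?_⟩⟩
  · refine le_trans ?_ (hlow v)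
    gcongr
    exact inv_le_of_inv_le₀ ha (by simp)
  · refine (hA v).2.trans ?_
    gcongr
    simp
end
end

section
/- Let α ∈ [0,1] and let g: ℝ³ → ℝ be measurable with ∫_{v·n>0} (v·n) g(v)² dv < ∞. Suppose g satisfies the Maxwell reflection boundary condition: g(v) = (1 − α) g(R v) + α P_γ g(v) for almost every v with v·n < 0. Then the function v ↦ (v·n) g(v)² is integrable on ℝ³ and ∫_{ℝ³} (v·n) g(v)² dv = α(2 − α) ∫_{v·n>0} (v·n) (g(v) − P_γ g(v))² dv. In particular this integral is nonnegative. -/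
open Real MeasureTheory
open scoped RealInnerProductSpace

noncomputable section

/-- The diffuse-reflection projection
`P_γ g(v) = √(2π μ(v)) ∫_{v'·n>0} (v'·n) √μ(v') g(v') dv'`. -/
def diffuseProj (n : EuclideanSpace ℝ (Fin 3)) (g : EuclideanSpace ℝ (Fin 3) → ℝ)
    (v : EuclideanSpace ℝ (Fin 3)) : ℝ :=
  Real.sqrt (2 * π * gaussMu v) *
    ∫ w in {w : EuclideanSpace ℝ (Fin 3) | 0 < ⟪w, n⟫}, ⟪w, n⟫ * Real.sqrt (gaussMu w) * g w

lemma gaussMu_pos (v : EuclideanSpace ℝ (Fin 3)) : 0 < gaussMu v := by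
  unfold gaussMu; positivity

lemma continuous_gaussMu : Continuous gaussMu := by
  unfold gaussMu; fun_prop

lemma measurableSet_outgoing (n : EuclideanSpace ℝ (Fin 3)) :
    MeasurableSet {v : EuclideanSpace ℝ (Fin 3) | 0 < ⟪v, n⟫} :=
  measurableSet_lt measurable_const (by fun_prop)

lemma integral_Ioi_mul_exp_neg_sq_half :
    ∫ t in Set.Ioi (0 : ℝ), t * Real.exp (-(1 / 2) * t ^ 2) = 1 := by
  have h := integral_rpow_mul_exp_neg_mul_rpow (p := 2) (q := 1) (b := 1 / 2)
    (by norm_num) (by norm_num) (by norm_num)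
  norm_num [Real.rpow_neg_one] at h
  norm_num
  exact h

/-- The half-space first moment of the Maxwellian in the direction of a unit vector. -/
lemma setIntegral_inner_mul_gaussMu {n : EuclideanSpace ℝ (Fin 3)} (hn : ‖n‖ = 1) :
    ∫ v in {v : EuclideanSpace ℝ (Fin 3) | 0 < ⟪v, n⟫}, ⟪v, n⟫ * gaussMu v = (√(2 * π))⁻¹ := by
  obtain ⟨b, hb⟩ := Orthonormal.exists_orthonormalBasis_extension_of_card_eq (𝕜 := ℝ)
    (E := EuclideanSpace ℝ (Fin 3)) (ι := Fin 3) (by simp) (v := fun _ => n) (s := {0})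
    ⟨fun _ => hn, fun i j hij => (hij (Subsingleton.elim i j)).elim⟩
  have hb0 : b 0 = n := hb 0 rfl
  let f : Fin 3 → ℝ → ℝ := ![
    (Set.Ioi 0).indicator fun t => t * Real.exp (-(1 / 2) * t ^ 2),
    fun t => Real.exp (-(1 / 2) * t ^ 2), fun t => Real.exp (-(1 / 2) * t ^ 2)]
  have hfac (v : EuclideanSpace ℝ (Fin 3)) :
      {v : EuclideanSpace ℝ (Fin 3) | 0 < ⟪v, n⟫}.indicator (fun v => ⟪v, n⟫ * gaussMu v) v
      = (2 * π) ^ (-(3 : ℝ) / 2) * ∏ i, f i ((b.repr v).ofLp i) := by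
    have hv : ⟪v, n⟫ = (b.repr v).ofLp 0 := by
      rw [b.repr_apply_apply, hb0, real_inner_comm]
    have hnorm : ‖v‖ ^ 2 = (b.repr v).ofLp 0 ^ 2 + (b.repr v).ofLp 1 ^ 2
        + (b.repr v).ofLp 2 ^ 2 := by
      rw [← b.repr.norm_map v, EuclideanSpace.real_norm_sq_eq, Fin.sum_univ_three]
    simp only [Set.indicator, Set.mem_ofPred_eq, hv, gaussMu, hnorm, Fin.prod_univ_three, f,
      Matrix.cons_val, Set.mem_Ioi]
    split_ifs
    · rw [show -((b.repr v).ofLp 0 ^ 2 + (b.repr v).ofLp 1 ^ 2 + (b.repr v).ofLp 2 ^ 2) / 2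
        = -(1 / 2) * (b.repr v).ofLp 0 ^ 2 + -(1 / 2) * (b.repr v).ofLp 1 ^ 2
          + -(1 / 2) * (b.repr v).ofLp 2 ^ 2 by ring, Real.exp_add, Real.exp_add]
      ring
    · simp
  have hpres := (PiLp.volume_preserving_ofLp (Fin 3)).comp b.measurePreserving_repr
  have hemb : MeasurableEmbedding (WithLp.ofLp ∘ b.repr : EuclideanSpace ℝ (Fin 3) → Fin 3 → ℝ) :=
    (MeasurableEquiv.toLp 2 (Fin 3 → ℝ)).symm.measurableEmbedding.comp
      b.repr.toHomeomorph.measurableEmbedding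
  rw [← integral_indicator (measurableSet_outgoing n)]
  simp_rw [hfac]
  rw [integral_const_mul]
  have hchange := hpres.integral_comp hemb (fun x => ∏ i, f i (x i))
  simp only [Function.comp_apply] at hchange
  rw [hchange, integral_fintype_prod_volume_eq_prod, Fin.prod_univ_three]
  simp only [f, Matrix.cons_val]
  rw [integral_indicator measurableSet_Ioi, integral_Ioi_mul_exp_neg_sq_half, integral_gaussian,
    one_mul, Real.mul_self_sqrt (by positivity), show π / (1 / 2) = 2 * π by ring,
    Real.sqrt_eq_rpow, ← Real.rpow_neg (by positivity)]
  nth_rewrite 2 [← Real.rpow_one (2 * π)]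
  rw [← Real.rpow_add (by positivity)]
  norm_num

lemma integrableOn_inner_mul_gaussMu {n : EuclideanSpace ℝ (Fin 3)} (hn : ‖n‖ = 1) :
    IntegrableOn (fun v : EuclideanSpace ℝ (Fin 3) => ⟪v, n⟫ * gaussMu v)
      {v : EuclideanSpace ℝ (Fin 3) | 0 < ⟪v, n⟫} := by
  by_contra h
  have h0 := setIntegral_inner_mul_gaussMu hn
  rw [integral_undef h] at h0
  have : 0 < (√(2 * π))⁻¹ := by positivity
  linarith

lemma integrableOn_inner_mul_sqrt_gaussMu_mul {n : EuclideanSpace ℝ (Fin 3)} (hn : ‖n‖ = 1)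
    {g : EuclideanSpace ℝ (Fin 3) → ℝ} (hg : Measurable g)
    (hout : IntegrableOn (fun v => ⟪v, n⟫ * g v ^ 2) {v : EuclideanSpace ℝ (Fin 3) | 0 < ⟪v, n⟫}) :
    IntegrableOn (fun v => ⟪v, n⟫ * √(gaussMu v) * g v)
      {v : EuclideanSpace ℝ (Fin 3) | 0 < ⟪v, n⟫} := by
  refine Integrable.mono' (hout.add (integrableOn_inner_mul_gaussMu hn)) ?_ ?_
  · have := continuous_gaussMu.measurable
    exact Measurable.aestronglyMeasurable (by fun_prop)
  · filter_upwards [ae_restrict_mem (measurableSet_outgoing n)] with v hv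
    have hv : 0 < ⟪v, n⟫ := hv
    have hs := Real.sq_sqrt (gaussMu_pos v).le
    have hamgm : |√(gaussMu v) * g v| ≤ g v ^ 2 + gaussMu v := by
      rw [abs_le]
      constructor <;> nlinarith [sq_nonneg (√(gaussMu v) + g v), sq_nonneg (√(gaussMu v) - g v),
        sq_nonneg (g v), sq_nonneg (√(gaussMu v))]
    rw [Real.norm_eq_abs, mul_assoc, abs_mul, abs_of_pos hv, Pi.add_apply, ← mul_add]
    exact mul_le_mul_of_nonneg_left hamgm hv.le

/-- On outgoing velocities, the weighted square norm of a combination `a g + b P_γ g`; the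
diffuse projection is orthogonal, which is why only two moments of `g` appear. -/
lemma setIntegral_inner_mul_sq_add_diffuseProj {n : EuclideanSpace ℝ (Fin 3)} (hn : ‖n‖ = 1)
    {g : EuclideanSpace ℝ (Fin 3) → ℝ} (hg : Measurable g)
    (hout : IntegrableOn (fun v => ⟪v, n⟫ * g v ^ 2) {v : EuclideanSpace ℝ (Fin 3) | 0 < ⟪v, n⟫})
    (a b : ℝ) :
    IntegrableOn (fun v => ⟪v, n⟫ * (a * g v + b * diffuseProj n g v) ^ 2)
      {v : EuclideanSpace ℝ (Fin 3) | 0 < ⟪v, n⟫} ∧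
    ∫ v in {v : EuclideanSpace ℝ (Fin 3) | 0 < ⟪v, n⟫},
        ⟪v, n⟫ * (a * g v + b * diffuseProj n g v) ^ 2 =
      a ^ 2 * (∫ v in {v : EuclideanSpace ℝ (Fin 3) | 0 < ⟪v, n⟫}, ⟪v, n⟫ * g v ^ 2)
        + (2 * a * b + b ^ 2) * (√(2 * π) *
          (∫ v in {v : EuclideanSpace ℝ (Fin 3) | 0 < ⟪v, n⟫}, ⟪v, n⟫ * √(gaussMu v) * g v) ^ 2) := by
  set k := ∫ v in {v : EuclideanSpace ℝ (Fin 3) | 0 < ⟪v, n⟫}, ⟪v, n⟫ * √(gaussMu v) * g v with hk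
  have hcross := integrableOn_inner_mul_sqrt_gaussMu_mul hn hg hout
  have hmu := integrableOn_inner_mul_gaussMu hn
  have hexpand : (fun v => ⟪v, n⟫ * (a * g v + b * diffuseProj n g v) ^ 2) = fun v =>
      a ^ 2 * (⟪v, n⟫ * g v ^ 2)
        + 2 * a * b * √(2 * π) * k * (⟪v, n⟫ * √(gaussMu v) * g v)
        + b ^ 2 * √(2 * π) ^ 2 * k ^ 2 * (⟪v, n⟫ * gaussMu v) := by
    funext v
    have hs := Real.sq_sqrt (gaussMu_pos v).le
    rw [diffuseProj, ← hk, Real.sqrt_mul (by positivity)]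
    linear_combination ⟪v, n⟫ * b ^ 2 * √(2 * π) ^ 2 * k ^ 2 * hs
  have h₁ := hout.const_mul (a ^ 2)
  have h₂ := hcross.const_mul (2 * a * b * √(2 * π) * k)
  have h₃ := hmu.const_mul (b ^ 2 * √(2 * π) ^ 2 * k ^ 2)
  rw [hexpand]
  refine ⟨(h₁.add h₂).add h₃, ?_⟩
  rw [integral_add (by exact h₁.add h₂) h₃, integral_add h₁ h₂, integral_const_mul,
    integral_const_mul, integral_const_mul, setIntegral_inner_mul_gaussMu hn, ← hk]
  have : √(2 * π) ≠ 0 := by positivity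
  field_simp
  ring

lemma reflection_orthogonal_singleton_apply {n : EuclideanSpace ℝ (Fin 3)} (hn : ‖n‖ = 1)
    (v : EuclideanSpace ℝ (Fin 3)) :
    (ℝ ∙ n)ᗮ.reflection v = v - (2 * ⟪v, n⟫) • n := by
  rw [Submodule.reflection_orthogonal_apply, Submodule.reflection_singleton_apply, hn,
    real_inner_comm]
  simp [mul_smul, two_smul]

lemma inner_reflection_orthogonal_singleton (n v : EuclideanSpace ℝ (Fin 3)) :
    ⟪(ℝ ∙ n)ᗮ.reflection v, n⟫ = -⟪v, n⟫ := by
  have h := (ℝ ∙ n)ᗮ.reflection.inner_map_map v n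
  rw [Submodule.reflection_orthogonalComplement_singleton_eq_neg, inner_neg_right] at h
  linarith

lemma diffuseProj_reflection (n : EuclideanSpace ℝ (Fin 3)) (g : EuclideanSpace ℝ (Fin 3) → ℝ)
    (K : Submodule ℝ (EuclideanSpace ℝ (Fin 3))) [K.HasOrthogonalProjection] (v : EuclideanSpace ℝ (Fin 3)) :
    diffuseProj n g (K.reflection v) = diffuseProj n g v := by
  simp [diffuseProj, gaussMu]

/-- For `g` satisfying the Maxwell reflection boundary condition with accommodation
coefficient `α ∈ [0,1]` and with finite outgoing energy flux, the boundary flux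
`∫ (v·n) g² dv` is well defined and equals
`α(2−α) ∫_{v·n>0} (v·n)(g − P_γ g)² dv ≥ 0`. -/
theorem maxwell_bc_boundary_flux
    (n : EuclideanSpace ℝ (Fin 3)) (hn : ‖n‖ = 1)
    (α : ℝ) (hα : α ∈ Set.Icc (0 : ℝ) 1)
    (g : EuclideanSpace ℝ (Fin 3) → ℝ) (hg : Measurable g)
    (hout : IntegrableOn (fun v => ⟪v, n⟫ * g v ^ 2)
      {v : EuclideanSpace ℝ (Fin 3) | 0 < ⟪v, n⟫})
    (hbc : ∀ᵐ v : EuclideanSpace ℝ (Fin 3), ⟪v, n⟫ < 0 →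
      g v = (1 - α) * g (v - (2 * ⟪v, n⟫) • n) + α * diffuseProj n g v) :
    Integrable (fun v : EuclideanSpace ℝ (Fin 3) => ⟪v, n⟫ * g v ^ 2) ∧
      (∫ (v : EuclideanSpace ℝ (Fin 3)), ⟪v, n⟫ * g v ^ 2) =
        α * (2 - α) *
          ∫ v in {v : EuclideanSpace ℝ (Fin 3) | 0 < ⟪v, n⟫},
            ⟪v, n⟫ * (g v - diffuseProj n g v) ^ 2 ∧
      0 ≤ ∫ (v : EuclideanSpace ℝ (Fin 3)), ⟪v, n⟫ * g v ^ 2 := by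
  set S := {v : EuclideanSpace ℝ (Fin 3) | 0 < ⟪v, n⟫} with hS
  set R := (ℝ ∙ n)ᗮ.reflection with hR
  set u : EuclideanSpace ℝ (Fin 3) → ℝ :=
    fun v => ⟪v, n⟫ * ((1 - α) * g v + α * diffuseProj n g v) ^ 2 with hu
  have hSm : MeasurableSet S := measurableSet_outgoing n
  have hRpres : MeasurePreserving R := R.measurePreserving
  have hRemb : MeasurableEmbedding R := R.toHomeomorph.measurableEmbedding
  obtain ⟨hui, huv⟩ := setIntegral_inner_mul_sq_add_diffuseProj hn hg hout (1 - α) α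
  obtain ⟨-, hdv⟩ := setIntegral_inner_mul_sq_add_diffuseProj hn hg hout 1 (-1)
  have hsplit : (fun v => ⟪v, n⟫ * g v ^ 2) =ᵐ[volume]
      fun v => S.indicator (fun v => ⟪v, n⟫ * g v ^ 2) v - S.indicator u (R v) := by
    filter_upwards [hbc] with v hv
    have hinner : ⟪R v, n⟫ = -⟪v, n⟫ := inner_reflection_orthogonal_singleton n v
    rcases lt_trichotomy ⟪v, n⟫ 0 with h | h | h
    · rw [Set.indicator_of_notMem (by simp [hS, h.le]),
        Set.indicator_of_mem (by simpa [hS, hinner] using h), hv h,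
        ← reflection_orthogonal_singleton_apply hn]
      simp only [hu, hinner]
      simp only [hR, diffuseProj_reflection]
      ring
    · rw [Set.indicator_of_notMem (by simp [hS, h]),
        Set.indicator_of_notMem (by simp [hS, hinner, h]), h]
      simp
    · rw [Set.indicator_of_mem (by simpa [hS] using h),
        Set.indicator_of_notMem (by simp [hS, hinner, h.le])]
      simp
  have hi₁ := hout.integrable_indicator hSm
  have hi₂ : Integrable (fun v => S.indicator u (R v)) :=
    (hRpres.integrable_comp_emb hRemb).2 (hui.integrable_indicator hSm)
  have hflux : (∫ v, ⟪v, n⟫ * g v ^ 2) = α * (2 - α) *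
      ∫ v in S, ⟪v, n⟫ * (g v - diffuseProj n g v) ^ 2 := by
    rw [integral_congr_ae hsplit, integral_sub hi₁ hi₂, hRpres.integral_comp hRemb,
      integral_indicator hSm, integral_indicator hSm, huv]
    simp only [one_mul, neg_one_mul, ← sub_eq_add_neg] at hdv
    rw [hdv]
    ring
  refine ⟨(hi₁.sub hi₂).congr hsplit.symm, hflux, ?_⟩
  rw [hflux]
  exact mul_nonneg (mul_nonneg hα.1 (by linarith [hα.2]))
    (setIntegral_nonneg hSm fun v hv => mul_nonneg (le_of_lt hv) (sq_nonneg _))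
end
end

section
/- For every A > 0 there exist ε₀ ∈ (0,1), α₀ ∈ (1/2, 1) and C > 0 such that for all ρ₀, θ₀ ∈ ℝ and u₀ ∈ ℝ³ with |ρ₀| ≤ A, |u₀| ≤ A, |θ₀| ≤ A, all ε ∈ (0, ε₀), and all v ∈ ℝ³, the local Maxwellian μ_ε(v) = (1 + ερ₀)(2π(1 + εθ₀))^{-3/2} exp(−|v − εu₀|²/(2(1 + εθ₀))) satisfies the second-order Taylor estimate |μ_ε(v) − μ(v) − ε(ρ₀ + v·u₀ + ((|v|² − 3)/2)θ₀) μ(v)| ≤ C ε² (1 + |v|)⁴ (μ(v))^{α₀}. -/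
open Real MeasureTheory
open scoped RealInnerProductSpace

noncomputable section

/-- Second-order Taylor estimate for the exponential, valid on the whole line. -/
theorem abs_exp_sub_one_sub_id_le_sq_mul_exp_abs (x : ℝ) :
    |Real.exp x - 1 - x| ≤ x ^ 2 * Real.exp |x| := by
  have h := Complex.norm_exp_sub_sum_le_norm_mul_exp (x : ℂ) 2
  have e : Complex.exp (x : ℂ) - ∑ m ∈ Finset.range 2, (x : ℂ) ^ m / (m.factorial : ℂ)
      = ((Real.exp x - 1 - x : ℝ) : ℂ) := by
    simp [Finset.sum_range_succ]
    ring
  rw [e, Complex.norm_real, Complex.norm_real, Real.norm_eq_abs, Real.norm_eq_abs, sq_abs] at h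
  exact h

/-- Second-order Taylor estimate for `t ↦ (1 + t) ^ (-3/2)` near the origin. -/
theorem abs_one_add_rpow_neg_three_halves_sub_le {t : ℝ} (ht : |t| ≤ 1 / 2) :
    |(1 + t) ^ (-(3 : ℝ) / 2) - 1 + 3 / 2 * t| ≤ 232 * t ^ 2 := by
  obtain ⟨h1, h2⟩ := abs_le.mp ht
  have hs : 0 ≤ 1 + t := by linarith
  obtain ⟨q, hq⟩ : ∃ q, q = √(1 + t) := ⟨_, rfl⟩
  have hq0 : 0 ≤ q := hq ▸ Real.sqrt_nonneg _
  have hqq : q ^ 2 = 1 + t := by rw [hq, Real.sq_sqrt hs]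
  have hq1 : 1 / 2 ≤ q := by nlinarith
  have hq2 : q ≤ 2 := by nlinarith
  have hpow : (1 + t) ^ (-(3 : ℝ) / 2) = (q ^ 3)⁻¹ := by
    rw [← hqq, ← Real.rpow_natCast, ← Real.rpow_natCast, ← Real.rpow_mul hq0,
      ← Real.rpow_neg hq0]
    norm_num
  obtain rfl : t = q ^ 2 - 1 := by linarith
  have hq3 : 0 < q ^ 3 := by positivity
  have hfac : (q ^ 3)⁻¹ - 1 + 3 / 2 * (q ^ 2 - 1)
      = (q - 1) ^ 2 * ((3 * q ^ 3 + 6 * q ^ 2 + 4 * q + 2) / (2 * q ^ 3)) := by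
    field_simp
    ring
  have hsq : (q - 1) ^ 2 ≤ (q ^ 2 - 1) ^ 2 := by
    have : (q ^ 2 - 1) ^ 2 = (q - 1) ^ 2 * (q + 1) ^ 2 := by ring
    rw [this]
    exact le_mul_of_one_le_right (sq_nonneg _) (by nlinarith)
  have hfrac : (3 * q ^ 3 + 6 * q ^ 2 + 4 * q + 2) / (2 * q ^ 3) ≤ 232 := by
    rw [div_le_iff₀ (by positivity)]
    have : (1 / 2 : ℝ) ^ 2 ≤ q ^ 2 := by gcongr
    have h3 : (1 / 2 : ℝ) ^ 3 ≤ q ^ 3 := by gcongr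
    nlinarith
  rw [hpow, hfac, abs_of_nonneg (by positivity), mul_comm]
  gcongr

/-- Multiplying first-order expansions `1 + a + r` and `1 + T + s` of `P` and `E`. -/
theorem abs_mul_sub_one_sub_le {P E a T r s δ : ℝ} (ha : |a| ≤ 1)
    (hE : 0 ≤ E) (hP : |P - 1 - a| ≤ r) (hEs : |E - 1 - T| ≤ s) (haT : |a * T| ≤ δ) :
    |P * E - 1 - (a + T)| ≤ δ + 2 * s + r * E := by
  have h : P * E - 1 - (a + T) = a * T + (1 + a) * (E - 1 - T) + (P - 1 - a) * E := by ring
  have h1 : |1 + a| ≤ 2 := (abs_add_le _ _).trans (by rw [abs_one]; linarith)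
  rw [h]
  refine (abs_add_three _ _ _).trans ?_
  rw [abs_mul (1 + a), abs_mul (P - 1 - a), abs_of_nonneg hE]
  gcongr

/-- The local Maxwellian divided by the global one, expanded to first order, with `n = |v|`,
`m = |u|` and `p = v · u`. -/
theorem abs_maxwellian_ratio_sub_le {B ε ρ θ n m p : ℝ} (hB : 1 ≤ B) (hε : 0 < ε)
    (hεB : ε * B ≤ 1 / 64) (hρ : |ρ| ≤ B) (hθ : |θ| ≤ B) (hn : 0 ≤ n) (hm : 0 ≤ m)
    (hmB : m ≤ B) (hp : |p| ≤ n * m) :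
    |(1 + ε * ρ) * (1 + ε * θ) ^ (-(3 : ℝ) / 2) *
        Real.exp ((n ^ 2 * (ε * θ) + 2 * ε * p - ε ^ 2 * m ^ 2) / (2 * (1 + ε * θ)))
      - 1 - ε * (ρ + p + (n ^ 2 - 3) / 2 * θ)| ≤
      493 * B ^ 2 * ε ^ 2 * (1 + n) ^ 4 * Real.exp (1 / 8 + n ^ 2 / 8) := by
  obtain ⟨d, hd⟩ : ∃ d, d = ε * B := ⟨_, rfl⟩
  rw [← hd] at hεB
  have hd0 : 0 ≤ d := by rw [hd]; positivity
  have hd2 : 493 * B ^ 2 * ε ^ 2 = 493 * d ^ 2 := by rw [hd]; ring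
  obtain ⟨w, hw⟩ : ∃ w, w = (1 + n) ^ 2 := ⟨_, rfl⟩
  have hw1 : 1 ≤ w := by nlinarith
  have hw4 : (1 + n) ^ 4 = w ^ 2 := by rw [hw]; ring
  have ht : |ε * θ| ≤ d := by
    rw [abs_mul, abs_of_pos hε, hd]; gcongr
  have hr : |ε * ρ| ≤ d := by
    rw [abs_mul, abs_of_pos hε, hd]; gcongr
  have hm2 : ε ^ 2 * m ^ 2 ≤ d ^ 2 := by
    rw [hd, mul_pow]; gcongr
  have hm20 : 0 ≤ ε ^ 2 * m ^ 2 := by positivity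
  obtain ⟨T, hT⟩ : ∃ T, T = ε * p + n ^ 2 / 2 * (ε * θ) := ⟨_, rfl⟩
  have hTb : |T| ≤ d * w := by
    have h1 : |ε * p| ≤ n * d := by
      rw [abs_mul, abs_of_pos hε, hd]
      calc ε * |p| ≤ ε * (n * B) := by gcongr; exact hp.trans (by gcongr)
        _ = n * (ε * B) := by ring
    have h2 : |n ^ 2 / 2 * (ε * θ)| ≤ n ^ 2 / 2 * d := by
      rw [abs_mul, abs_of_nonneg (by positivity : 0 ≤ n ^ 2 / 2)]; gcongr
    rw [hT, hw]
    refine (abs_add_le _ _).trans ?_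
    nlinarith [mul_nonneg hd0 hn, mul_nonneg hd0 (sq_nonneg n)]
  obtain ⟨t, ht'⟩ : ∃ t, t = ε * θ := ⟨_, rfl⟩
  obtain ⟨b, hb⟩ : ∃ b, b = ε * ρ := ⟨_, rfl⟩
  obtain ⟨k, hk⟩ : ∃ k, k = ε ^ 2 * m ^ 2 := ⟨_, rfl⟩
  have hlin : ε * (ρ + p + (n ^ 2 - 3) / 2 * θ) = (b - 3 / 2 * t) + T := by
    rw [hT, hb, ht']; ring
  have hnum : n ^ 2 * (ε * θ) + 2 * ε * p - ε ^ 2 * m ^ 2 = 2 * T - k := by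
    rw [hT, hk]; ring
  rw [hlin, hnum, hd2, hw4, ← ht', ← hb]
  rw [← ht'] at ht
  rw [← hb] at hr
  rw [← hk] at hm2 hm20
  have hsum : |2 * T - k| ≤ 2 * (d * w) + d ^ 2 := by
    refine (abs_sub _ _).trans ?_
    rw [abs_mul, abs_two, abs_of_nonneg hm20]
    linarith
  have hs : 1 / 2 ≤ 1 + t := by linarith [(abs_le.mp ht).1]
  have hdw : d ^ 2 ≤ d * w := by nlinarith
  obtain ⟨E, hE⟩ : ∃ E, E = (2 * T - k) / (2 * (1 + t)) := ⟨_, rfl⟩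
  have hEb : |E| ≤ 3 * (d * w) := by
    rw [hE, abs_div, abs_of_pos (by linarith : 0 < 2 * (1 + t)), div_le_iff₀ (by linarith)]
    have h := le_mul_of_one_le_right (by positivity : 0 ≤ 3 * (d * w))
      (by linarith : 1 ≤ 2 * (1 + t))
    linarith
  have hET : |E - T| ≤ 3 * d ^ 2 * w := by
    have h : E - T = (-(2 * T * t) - k) / (2 * (1 + t)) := by
      rw [hE]; field_simp; ring
    have h1 : |-(2 * T * t) - k| ≤ 2 * (d * w) * d + d ^ 2 := by
      refine (abs_sub _ _).trans ?_
      rw [abs_neg, abs_mul, abs_mul, abs_two, abs_of_nonneg hm20]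
      gcongr
    rw [h, abs_div, abs_of_pos (by linarith : 0 < 2 * (1 + t)), div_le_iff₀ (by linarith)]
    have h2 := le_mul_of_one_le_right (by positivity : 0 ≤ 3 * d ^ 2 * w)
      (by linarith : 1 ≤ 2 * (1 + t))
    have h3 := le_mul_of_one_le_right (sq_nonneg d) hw1
    linarith
  obtain ⟨G, hG⟩ : ∃ G, G = Real.exp (1 / 8 + n ^ 2 / 8) := ⟨_, rfl⟩
  have hG1 : 1 ≤ G := by rw [hG]; exact Real.one_le_exp (by positivity)
  have hEG : Real.exp |E| ≤ G := by
    rw [hG]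
    apply Real.exp_le_exp.mpr
    refine hEb.trans ?_
    have : d * w ≤ 1 / 64 * w := by gcongr
    rw [hw] at this ⊢
    linarith [sq_nonneg (n - 1), sq_nonneg n]
  have hEG' : Real.exp E ≤ G := (Real.exp_le_exp.mpr (le_abs_self E)).trans hEG
  have hexp : |Real.exp E - 1 - T| ≤ 12 * (d ^ 2 * w ^ 2 * G) := by
    have h1 := abs_exp_sub_one_sub_id_le_sq_mul_exp_abs E
    have h2 : E ^ 2 ≤ (3 * (d * w)) ^ 2 := by
      rw [← sq_abs]; gcongr
    have h3 : E ^ 2 * Real.exp |E| ≤ (3 * (d * w)) ^ 2 * G := by gcongr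
    have h4 : d ^ 2 * w ≤ d ^ 2 * w ^ 2 * G := by
      calc d ^ 2 * w = d ^ 2 * w * 1 * 1 := by ring
        _ ≤ d ^ 2 * w * w * G := by gcongr
        _ = _ := by ring
    have h5 : Real.exp E - 1 - T = (Real.exp E - 1 - E) + (E - T) := by ring
    rw [h5]
    refine (abs_add_le _ _).trans ?_
    linarith
  have hpre : |(1 + b) * (1 + t) ^ (-(3 : ℝ) / 2) - 1 - (b - 3 / 2 * t)| ≤ 466 * d ^ 2 := by
    have h1 := abs_one_add_rpow_neg_three_halves_sub_le (t := t) (by linarith)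
    have h2 : (1 + b) * (1 + t) ^ (-(3 : ℝ) / 2) - 1 - (b - 3 / 2 * t) =
        (1 + b) * ((1 + t) ^ (-(3 : ℝ) / 2) - 1 + 3 / 2 * t) - 3 / 2 * (b * t) := by ring
    have h3 : |1 + b| ≤ 2 := (abs_add_le _ _).trans (by rw [abs_one]; linarith)
    have h4 : t ^ 2 ≤ d ^ 2 := by rw [← sq_abs]; gcongr
    have h5 : |b * t| ≤ d * d := by rw [abs_mul]; gcongr
    have h6 : |(1 + b) * ((1 + t) ^ (-(3 : ℝ) / 2) - 1 + 3 / 2 * t)| ≤ 2 * (232 * t ^ 2) := by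
      rw [abs_mul]; gcongr
    have h7 : |3 / 2 * (b * t)| ≤ 3 / 2 * (d * d) := by
      rw [abs_mul, abs_of_pos (by norm_num : (0 : ℝ) < 3 / 2)]; gcongr
    rw [h2]
    refine (abs_sub _ _).trans ?_
    linarith [sq_nonneg d]
  have ha : |b - 3 / 2 * t| ≤ 5 / 2 * d := by
    refine (abs_sub _ _).trans ?_
    rw [abs_mul, abs_of_pos (by norm_num : (0 : ℝ) < 3 / 2)]
    linarith
  have haT : |(b - 3 / 2 * t) * T| ≤ 5 / 2 * d * (d * w) := by
    rw [abs_mul]; gcongr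
  rw [← hE, ← hG]
  refine (abs_mul_sub_one_sub_le (by linarith) (Real.exp_pos E).le hpre hexp haT).trans ?_
  have h1 : d ^ 2 * w ≤ d ^ 2 * w ^ 2 * G := by
    calc d ^ 2 * w = d ^ 2 * w * 1 * 1 := by ring
      _ ≤ d ^ 2 * w * w * G := by gcongr
      _ = _ := by ring
  have h2 : d ^ 2 * Real.exp E ≤ d ^ 2 * w ^ 2 * G := by
    calc d ^ 2 * Real.exp E = d ^ 2 * 1 * Real.exp E := by ring
      _ ≤ d ^ 2 * w ^ 2 * G := by gcongr; exact one_le_pow₀ hw1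
  have h3 : 0 ≤ d ^ 2 * w ^ 2 * G := by positivity
  linarith

/-- A Gaussian growth factor is absorbed by lowering the power of the global Maxwellian. -/
theorem gaussMu_mul_exp_le (v : EuclideanSpace ℝ (Fin 3)) :
    gaussMu v * Real.exp (1 / 8 + ‖v‖ ^ 2 / 8) ≤
      Real.exp (1 / 8) * gaussMu v ^ (3 / 4 : ℝ) := by
  have hπ : (1 : ℝ) ≤ 2 * π := by linarith [Real.pi_gt_three]
  have hc : 0 < (2 * π) ^ (-(3 : ℝ) / 2) := by positivity
  have hc1 : (2 * π) ^ (-(3 : ℝ) / 2) ≤ 1 :=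
    Real.rpow_le_one_of_one_le_of_nonpos hπ (by norm_num)
  have hc2 : (2 * π) ^ (-(3 : ℝ) / 2) ≤ ((2 * π) ^ (-(3 : ℝ) / 2)) ^ (3 / 4 : ℝ) := by
    conv_lhs => rw [← Real.rpow_one ((2 * π) ^ (-(3 : ℝ) / 2))]
    exact Real.rpow_le_rpow_of_exponent_ge hc hc1 (by norm_num)
  have he : Real.exp (-‖v‖ ^ 2 / 2) * Real.exp (1 / 8 + ‖v‖ ^ 2 / 8) =
      Real.exp (1 / 8) * Real.exp (-‖v‖ ^ 2 / 2) ^ (3 / 4 : ℝ) := by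
    rw [← Real.exp_mul, ← Real.exp_add, ← Real.exp_add]
    ring_nf
  rw [gaussMu, Real.mul_rpow hc.le (Real.exp_pos _).le, mul_assoc, he, mul_left_comm]
  gcongr

/-- Second-order Taylor estimate for the local Maxwellian
`μ_ε(v) = (1+ερ₀)(2π(1+εθ₀))^{−3/2} exp(−|v−εu₀|²/(2(1+εθ₀)))`:
`|μ_ε − μ − ε(ρ₀ + v·u₀ + ((|v|²−3)/2)θ₀)μ| ≤ Cε²(1+|v|)⁴ μ^{α₀}`. -/
theorem localMaxwellian_taylor_expansion (A : ℝ) (hA : 0 < A) :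
    ∃ ε₀ ∈ Set.Ioo (0 : ℝ) 1, ∃ α₀ ∈ Set.Ioo (1 / 2 : ℝ) 1, ∃ C > (0 : ℝ),
      ∀ ρ₀ θ₀ : ℝ, ∀ u₀ : EuclideanSpace ℝ (Fin 3),
        |ρ₀| ≤ A → ‖u₀‖ ≤ A → |θ₀| ≤ A →
        ∀ ε ∈ Set.Ioo (0 : ℝ) ε₀, ∀ v : EuclideanSpace ℝ (Fin 3),
          |(1 + ε * ρ₀) * (2 * π * (1 + ε * θ₀)) ^ (-(3 : ℝ) / 2) *
              Real.exp (-‖v - ε • u₀‖ ^ 2 / (2 * (1 + ε * θ₀))) -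
            gaussMu v -
            ε * ((ρ₀ + ⟪v, u₀⟫ + (‖v‖ ^ 2 - 3) / 2 * θ₀) * gaussMu v)| ≤
          C * ε ^ 2 * (1 + ‖v‖) ^ 4 * (gaussMu v) ^ α₀ := by
  have hB : 0 < 1 + A := by linarith
  refine ⟨1 / (64 * (1 + A)), ⟨by positivity, ?_⟩, 3 / 4, ⟨by norm_num, by norm_num⟩,
    493 * (1 + A) ^ 2 * Real.exp (1 / 8), by positivity, ?_⟩
  · rw [div_lt_one (by positivity)]
    linarith
  intro ρ θ u hρ hu hθ ε ⟨hε, hε1⟩ v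
  have hεB : ε * (1 + A) ≤ 1 / 64 := by
    rw [lt_div_iff₀ (by positivity)] at hε1
    linarith
  have hratio := abs_maxwellian_ratio_sub_le (by linarith : 1 ≤ 1 + A) hε hεB
    (by linarith : |ρ| ≤ 1 + A) (by linarith : |θ| ≤ 1 + A) (norm_nonneg v) (norm_nonneg u)
    (by linarith) (abs_real_inner_le_norm v u)
  have hs : 0 < 1 + ε * θ := by
    have : |ε * θ| ≤ ε * (1 + A) := by
      rw [abs_mul, abs_of_pos hε]; gcongr; linarith
    linarith [neg_abs_le (ε * θ)]
  have hnorm : ‖v - ε • u‖ ^ 2 = ‖v‖ ^ 2 - 2 * ε * ⟪v, u⟫ + ε ^ 2 * ‖u‖ ^ 2 := by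
    rw [norm_sub_sq_real, real_inner_smul_right, norm_smul, Real.norm_eq_abs, mul_pow, sq_abs]
    ring
  have hexp : Real.exp (-‖v - ε • u‖ ^ 2 / (2 * (1 + ε * θ))) = Real.exp (-‖v‖ ^ 2 / 2) *
      Real.exp ((‖v‖ ^ 2 * (ε * θ) + 2 * ε * ⟪v, u⟫ - ε ^ 2 * ‖u‖ ^ 2) /
        (2 * (1 + ε * θ))) := by
    rw [← Real.exp_add, hnorm]
    congr 1
    field_simp
    ring
  have hμ : 0 ≤ gaussMu v := by unfold gaussMu; positivity
  have hfactor : (1 + ε * ρ) * (2 * π * (1 + ε * θ)) ^ (-(3 : ℝ) / 2) *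
        Real.exp (-‖v - ε • u‖ ^ 2 / (2 * (1 + ε * θ))) - gaussMu v -
        ε * ((ρ + ⟪v, u⟫ + (‖v‖ ^ 2 - 3) / 2 * θ) * gaussMu v) =
      ((1 + ε * ρ) * (1 + ε * θ) ^ (-(3 : ℝ) / 2) *
        Real.exp ((‖v‖ ^ 2 * (ε * θ) + 2 * ε * ⟪v, u⟫ - ε ^ 2 * ‖u‖ ^ 2) /
          (2 * (1 + ε * θ))) - 1 - ε * (ρ + ⟪v, u⟫ + (‖v‖ ^ 2 - 3) / 2 * θ)) * gaussMu v := by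
    rw [hexp, Real.mul_rpow (by positivity) hs.le, gaussMu]
    ring
  rw [hfactor, abs_mul, abs_of_nonneg hμ]
  calc _ ≤ 493 * (1 + A) ^ 2 * ε ^ 2 * (1 + ‖v‖) ^ 4 * Real.exp (1 / 8 + ‖v‖ ^ 2 / 8) *
        gaussMu v := by gcongr
    _ = 493 * (1 + A) ^ 2 * ε ^ 2 * (1 + ‖v‖) ^ 4 *
        (gaussMu v * Real.exp (1 / 8 + ‖v‖ ^ 2 / 8)) := by ring
    _ ≤ 493 * (1 + A) ^ 2 * ε ^ 2 * (1 + ‖v‖) ^ 4 *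
        (Real.exp (1 / 8) * gaussMu v ^ (3 / 4 : ℝ)) := by
      exact mul_le_mul_of_nonneg_left (gaussMu_mul_exp_le v) (by positivity)
    _ = _ := by ring
end
end

section
/- Let −3 < γ ≤ 1 and c > 0. Then there exists C > 0 such that for all v ∈ ℝ³: ∫_{ℝ³} exp(−c|v − v'|²) / (|v − v'| (1 + |v| + |v'|)^{1−γ}) dv' ≤ C (1 + |v|²)^{γ/2}. -/
open Real MeasureTheory

noncomputable section

/-- The singular Gaussian `exp(−c|u|²)/|u|` is integrable on `ℝ³`. -/
theorem integrable_exp_neg_mul_norm_sq_div_norm {c : ℝ} (hc : 0 < c) :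
    Integrable fun u : EuclideanSpace ℝ (Fin 3) ↦ Real.exp (-c * ‖u‖ ^ 2) / ‖u‖ := by
  refine (integrable_fun_norm_addHaar (volume : Measure (EuclideanSpace ℝ (Fin 3)))
    (f := fun y : ℝ ↦ Real.exp (-c * y ^ 2) / y)).2 ?_
  refine (integrable_mul_exp_neg_mul_sq hc).integrableOn.congr_fun (fun y hy ↦ ?_)
    measurableSet_Ioi
  have hy0 : y ≠ 0 := (Set.mem_Ioi.1 hy).ne'
  simp only [finrank_euclideanSpace, Fintype.card_fin, smul_eq_mul]
  field_simp

/-- The inverse of `(1+x)^{1−γ}` is at most `(1+x²)^{γ/2}` for `γ ≤ 1`. -/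
theorem inv_one_add_rpow_one_sub_le {γ x : ℝ} (hγ : γ ≤ 1) (hx : 0 ≤ x) :
    ((1 + x) ^ (1 - γ))⁻¹ ≤ (1 + x ^ 2) ^ (γ / 2) := by
  have hle : (1 + x ^ 2) ^ ((1 - γ) / 2) ≤ (1 + x) ^ (1 - γ) := by
    calc (1 + x ^ 2) ^ ((1 - γ) / 2) ≤ ((1 + x) ^ 2) ^ ((1 - γ) / 2) :=
          Real.rpow_le_rpow (by positivity) (by nlinarith) (by linarith)
      _ = (1 + x) ^ (1 - γ) := by
          rw [← Real.rpow_natCast, ← Real.rpow_mul (by positivity)]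
          congr 1
          push_cast
          ring
  calc ((1 + x) ^ (1 - γ))⁻¹ ≤ ((1 + x ^ 2) ^ ((1 - γ) / 2))⁻¹ :=
        inv_anti₀ (by positivity) hle
    _ = (1 + x ^ 2) ^ (-((1 - γ) / 2)) := (Real.rpow_neg (by positivity) _).symm
    _ ≤ (1 + x ^ 2) ^ (γ / 2) :=
        Real.rpow_le_rpow_of_exponent_le (by nlinarith [sq_nonneg x]) (by linarith)

/-- The `v'`-integral of the kernel bound
`exp(−c|v−v'|²)/(|v−v'|(1+|v|+|v'|)^{1−γ})` is dominated by the collision frequency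
`(1+|v|²)^{γ/2}`. -/
theorem kernel_integral_le_collisionFrequency
    (γ c : ℝ) (hγ₁ : -3 < γ) (hγ₂ : γ ≤ 1) (hc : 0 < c) :
    ∃ C > (0 : ℝ), ∀ v : EuclideanSpace ℝ (Fin 3),
      (∫ (w : EuclideanSpace ℝ (Fin 3)),
        Real.exp (-c * ‖v - w‖ ^ 2) / (‖v - w‖ * (1 + ‖v‖ + ‖w‖) ^ (1 - γ))) ≤
      C * (1 + ‖v‖ ^ 2) ^ (γ / 2) := by
  set f : EuclideanSpace ℝ (Fin 3) → ℝ := fun u ↦ Real.exp (-c * ‖u‖ ^ 2) / ‖u‖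
  have hf0 : ∀ u, 0 ≤ f u := fun u ↦ by positivity
  have hK : 0 ≤ ∫ u, f u := integral_nonneg hf0
  refine ⟨(∫ u, f u) + 1, by linarith, fun v ↦ ?_⟩
  have hint : Integrable fun w ↦ f (v - w) :=
    (integrable_exp_neg_mul_norm_sq_div_norm hc).comp_sub_left v
  calc (∫ w : EuclideanSpace ℝ (Fin 3),
        Real.exp (-c * ‖v - w‖ ^ 2) / (‖v - w‖ * (1 + ‖v‖ + ‖w‖) ^ (1 - γ)))
      ≤ ∫ w, f (v - w) * ((1 + ‖v‖) ^ (1 - γ))⁻¹ := by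
        refine integral_mono_of_nonneg (.of_forall fun w ↦ by positivity)
          (hint.mul_const _) (.of_forall fun w ↦ ?_)
        have hw : (1 + ‖v‖) ^ (1 - γ) ≤ (1 + ‖v‖ + ‖w‖) ^ (1 - γ) :=
          Real.rpow_le_rpow (by positivity) (by linarith [norm_nonneg w]) (by linarith)
        calc Real.exp (-c * ‖v - w‖ ^ 2) / (‖v - w‖ * (1 + ‖v‖ + ‖w‖) ^ (1 - γ))
            = f (v - w) * ((1 + ‖v‖ + ‖w‖) ^ (1 - γ))⁻¹ := by
              rw [← div_div, div_eq_mul_inv]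
          _ ≤ f (v - w) * ((1 + ‖v‖) ^ (1 - γ))⁻¹ :=
              mul_le_mul_of_nonneg_left (inv_anti₀ (by positivity) hw) (hf0 _)
    _ = (∫ u, f u) * ((1 + ‖v‖) ^ (1 - γ))⁻¹ := by
        rw [integral_mul_const, integral_sub_left_eq_self f volume v]
    _ ≤ ((∫ u, f u) + 1) * (1 + ‖v‖ ^ 2) ^ (γ / 2) :=
        mul_le_mul (by linarith) (inv_one_add_rpow_one_sub_le hγ₂ (norm_nonneg v))
          (by positivity) (by linarith)
end
end
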